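/- Let d be a positive integer and let J ⊊ I be squarefree monomial ideals of S such that I is generated by squarefree monomials f_1,…,f_r of degree d and J is either 0 or generated by squarefree monomials of degrees ≥ d+1. Let B be the set of squarefree monomials of degree d+1 in I∖J. Assume that for every b ∈ B, every degree-d monomial divisor of b belongs to {f_1,…,f_r}. Then depth_S I/J = d. -/

import Mathlib

open MvPolynomial

/-- The squarefree monomial `∏_{i ∈ T} x_i` in `K[x_1,…,x_n]`. -/
noncomputable def sqm (K : Type*) [Field K] {n : ℕ} (T : Finset (Fin n)) :
    MvPolynomial (Fin n) K := ∏ i ∈ T, X i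

/-- The poset `P_{I \ J}` of (supports of) squarefree monomials of `I \ J`. -/
def sqPoset {K : Type*} [Field K] {n : ℕ} (I J : Ideal (MvPolynomial (Fin n) K)) :
    Set (Finset (Fin n)) :=
  {T | sqm K T ∈ I ∧ sqm K T ∉ J}

/-- The squarefree monomials of degree `k` in `I \ J`. -/
def degSet {K : Type*} [Field K] {n : ℕ} (I J : Ideal (MvPolynomial (Fin n) K)) (k : ℕ) :
    Set (Finset (Fin n)) :=
  {T ∈ sqPoset I J | T.card = k}

/-- A partition of `P_{I\J}` into intervals `[u,v]`, recorded as a finite set of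
pairs `(u, v)`: each monomial of `P_{I\J}` lies in exactly one interval. -/
def IsIntervalPartition {K : Type*} [Field K] {n : ℕ}
    (I J : Ideal (MvPolynomial (Fin n) K))
    (F : Finset (Finset (Fin n) × Finset (Fin n))) : Prop :=
  (∀ p ∈ F, p.1 ∈ sqPoset I J ∧ p.2 ∈ sqPoset I J ∧ p.1 ⊆ p.2) ∧
  (∀ T ∈ sqPoset I J, ∃! p, p ∈ F ∧ p.1 ⊆ T ∧ T ⊆ p.2)

/-- The Stanley depth of `I/J`: the maximum over interval partitions of the
minimal degree of an upper endpoint. -/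
noncomputable def sdepth {K : Type*} [Field K] {n : ℕ}
    (I J : Ideal (MvPolynomial (Fin n) K)) : ℕ :=
  sSup {k | ∃ F, IsIntervalPartition I J F ∧ ∀ p ∈ F, k ≤ p.2.card}

/-- The depth of a module over `K[x_1,…,x_n]` with respect to the maximal ideal
`(x_1,…,x_n)`: the supremum of lengths of regular sequences from `(x_1,…,x_n)`. -/
noncomputable def mdepth {K : Type*} [Field K] {n : ℕ}
    (M : Type*) [AddCommGroup M] [Module (MvPolynomial (Fin n) K) M] : ℕ :=
  sSup {k | ∃ rs : List (MvPolynomial (Fin n) K), rs.length = k ∧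
    (∀ r ∈ rs, r ∈ Ideal.span (Set.range X : Set (MvPolynomial (Fin n) K))) ∧
    RingTheory.Sequence.IsRegular M rs}

/-- The `S`-module `I/J` (more precisely `I/(J ∩ I)`). -/
abbrev quotMod {K : Type*} [Field K] {n : ℕ} (I J : Ideal (MvPolynomial (Fin n) K)) :=
  I ⧸ (Submodule.comap I.subtype J)

/-- `depth_S I/J`. -/
noncomputable def depthIJ {K : Type*} [Field K] {n : ℕ}
    (I J : Ideal (MvPolynomial (Fin n) K)) : ℕ :=
  mdepth (K := K) (n := n) (quotMod I J)

/-- An ideal is a squarefree monomial ideal generated in degrees `≥ d` if it is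
the span of squarefree monomials whose supports have at least `d` elements. -/
def SqfreeGenFrom {K : Type*} [Field K] {n : ℕ}
    (L : Ideal (MvPolynomial (Fin n) K)) (d : ℕ) : Prop :=
  ∃ G : Set (Finset (Fin n)), (∀ T ∈ G, d ≤ T.card) ∧ L = Ideal.span (sqm K '' G)

/-- A squarefree monomial ideal. -/
def IsSqfreeMonomialIdeal {K : Type*} [Field K] {n : ℕ}
    (L : Ideal (MvPolynomial (Fin n) K)) : Prop :=
  ∃ G : Set (Finset (Fin n)), L = Ideal.span (sqm K '' G)

section Koszul

variable {R ι M N P : Type*} [CommRing R] [AddCommGroup M] [Module R M]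
  [AddCommGroup N] [Module R N] [AddCommGroup P] [Module R P]

/-- The Koszul differential on cochains indexed by all (not necessarily alternating) tuples. -/
def koszulDiff (x : ι → R) (i : ℕ) : ((Fin i → ι) → M) →ₗ[R] ((Fin (i + 1) → ι) → M) where
  toFun c j := ∑ k : Fin (i + 1), ((-1) ^ (k : ℕ) * x (j k)) • c (fun l => j (k.succAbove l))
  map_add' c c' := by
    ext j
    simp [smul_add, Finset.sum_add_distrib]
  map_smul' r c := by
    ext j
    simp [Finset.smul_sum, smul_smul, mul_comm]

lemma koszulDiff_apply (x : ι → R) (i : ℕ) (c : (Fin i → ι) → M) (j : Fin (i + 1) → ι) :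
    koszulDiff x i c j =
      ∑ k : Fin (i + 1), ((-1) ^ (k : ℕ) * x (j k)) • c (fun l => j (k.succAbove l)) := rfl

lemma koszulDiff_zero_apply (x : ι → R) (c : (Fin 0 → ι) → M) (j : Fin 1 → ι) :
    koszulDiff x 0 c j = x (j 0) • c Fin.elim0 := by
  simp only [koszulDiff_apply, Fin.sum_univ_succ, Fin.sum_univ_zero]
  simp [Subsingleton.elim _ (Fin.elim0 : Fin 0 → ι)]

lemma koszulDiff_cons (x : ι → R) (i : ℕ) (c : (Fin (i + 1) → ι) → M) (p : ι)
    (l : Fin (i + 1) → ι) :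
    koszulDiff x (i + 1) c (Fin.cons p l) =
      x p • c l - koszulDiff x i (fun l' => c (Fin.cons p l')) l := by
  rw [koszulDiff_apply, Fin.sum_univ_succ, koszulDiff_apply, sub_eq_add_neg,
    ← Finset.sum_neg_distrib]
  congr 1
  · simp
  · refine Finset.sum_congr rfl fun k _ => ?_
    have : (fun l' => (Fin.cons p l : Fin (i + 2) → ι) (k.succ.succAbove l')) =
        Fin.cons p (fun l' => l (k.succAbove l')) := by
      ext l'
      refine Fin.cases ?_ (fun q => ?_) l' <;> simp
    rw [this]
    simp [pow_succ]

lemma koszulDiff_comp_self (x : ι → R) (i : ℕ) (c : (Fin i → ι) → M) :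
    koszulDiff x (i + 1) (koszulDiff x i c) = 0 := by
  induction i with
  | zero =>
    ext j
    obtain ⟨p, l, rfl⟩ : ∃ p l, j = Fin.cons p l := ⟨j 0, Fin.tail j, (Fin.cons_self_tail j).symm⟩
    rw [koszulDiff_cons]
    simp [koszulDiff_zero_apply, smul_smul, mul_comm]
  | succ i ih =>
    ext j
    obtain ⟨p, l, rfl⟩ : ∃ p l, j = Fin.cons p l := ⟨j 0, Fin.tail j, (Fin.cons_self_tail j).symm⟩
    rw [koszulDiff_cons]
    have : (fun l' => koszulDiff x (i + 1) c (Fin.cons p l')) =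
        x p • c - koszulDiff x i (fun l' => c (Fin.cons p l')) := by
      ext l'
      rw [koszulDiff_cons]
      rfl
    rw [this, map_sub, ih, map_smul]
    simp

lemma koszulDiff_map (x : ι → R) (i : ℕ) (g : M →ₗ[R] N) (c : (Fin i → ι) → M) :
    koszulDiff x i (g ∘ c) = g ∘ koszulDiff x i c := by
  ext j
  simp [koszulDiff_apply]

lemma sum_smul_eq_zero_of_koszulDiff_eq_zero [Fintype ι] (x a : ι → R) (c : (Fin 0 → ι) → M)
    (hc : koszulDiff x 0 c = 0) : (∑ p, a p * x p) • c = 0 := by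
  ext l
  have h (p : ι) : x p • c l = 0 := by
    have := congrFun hc (fun _ => p)
    rwa [koszulDiff_zero_apply, Subsingleton.elim Fin.elim0 l] at this
  simp [Finset.sum_smul, mul_smul, h]

lemma sum_smul_eq_koszulDiff [Fintype ι] (x a : ι → R) (i : ℕ) (c : (Fin (i + 1) → ι) → M)
    (hc : koszulDiff x (i + 1) c = 0) :
    (∑ p, a p * x p) • c = koszulDiff x i (∑ p, a p • fun l => c (Fin.cons p l)) := by
  ext l
  have h (p : ι) : x p • c l = koszulDiff x i (fun l' => c (Fin.cons p l')) l := by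
    have := congrFun hc (Fin.cons p l)
    rwa [koszulDiff_cons, Pi.zero_apply, sub_eq_zero] at this
  simp [Finset.sum_smul, mul_smul, h]

/-- Coboundaries of the Koszul complex on tuples. -/
def IsKoszulCoboundary (x : ι → R) : (i : ℕ) → ((Fin i → ι) → M) → Prop
  | 0, c => c = 0
  | i + 1, c => ∃ b, koszulDiff x i b = c

variable (M) in
/-- The Koszul cohomology of `M` on tuples vanishes in degrees `< k`. -/
def KoszulAcyclicBelow (x : ι → R) (k : ℕ) : Prop :=
  ∀ i < k, ∀ c : (Fin i → ι) → M, koszulDiff x i c = 0 → IsKoszulCoboundary x i c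

lemma KoszulAcyclicBelow.of_exact {x : ι → R} {k : ℕ} {f : N →ₗ[R] M} {g : M →ₗ[R] P}
    (hf : Function.Injective f) (hfg : Function.Exact f g) (hg : Function.Surjective g)
    (hN : KoszulAcyclicBelow N x k) (hP : KoszulAcyclicBelow P x k) :
    KoszulAcyclicBelow M x k := by
  have lift (i : ℕ) (c : (Fin i → ι) → M) (hc : g ∘ c = 0) : ∃ c', f ∘ c' = c := by
    choose c' hc' using fun j => (hfg (c j)).1 (congrFun hc j)
    exact ⟨c', funext hc'⟩
  have lift_cocycle (i : ℕ) (c : (Fin i → ι) → M) (hc : g ∘ c = 0) (hd : koszulDiff x i c = 0) :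
      ∃ c', f ∘ c' = c ∧ koszulDiff x i c' = 0 := by
    obtain ⟨c', rfl⟩ := lift i c hc
    refine ⟨c', rfl, ?_⟩
    rw [koszulDiff_map] at hd
    ext j
    exact hf (by simpa using congrFun hd j)
  intro i hi c hc
  have hgc : IsKoszulCoboundary x i (g ∘ c) := hP i hi _ (by ext; simp [koszulDiff_map, hc])
  cases i with
  | zero =>
    obtain ⟨c', rfl, h⟩ := lift_cocycle 0 c hgc hc
    have h0 : c' = 0 := hN 0 hi c' h
    subst h0
    ext; simp
  | succ i =>
    obtain ⟨b, hb⟩ := hgc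
    obtain ⟨b', rfl⟩ := hg.comp_left b
    rw [koszulDiff_map] at hb
    obtain ⟨c', hc', h⟩ := lift_cocycle (i + 1) (c - koszulDiff x i b')
      (by ext j; simpa [sub_eq_zero] using (congrFun hb j).symm)
      (by rw [map_sub, hc, koszulDiff_comp_self, sub_zero])
    obtain ⟨e, rfl⟩ := hN (i + 1) hi c' h
    refine ⟨b' + f ∘ e, ?_⟩
    rw [map_add, koszulDiff_map, hc']
    abel

section Quotient

variable {x : ι → R} {k : ℕ} {y : R} {g : M →ₗ[R] N}

lemma exists_eq_smul_of_comp_eq_zero (hk : ∀ m, g m = 0 → ∃ m', m = y • m') {i : ℕ}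
    (c : (Fin i → ι) → M) (hc : g ∘ c = 0) : ∃ c', c = y • c' := by
  choose c' hc' using fun j => hk (c j) (congrFun hc j)
  exact ⟨c', funext hc'⟩

lemma eq_zero_of_smul_cochain_eq_zero (hy : IsSMulRegular M y) {i : ℕ} (c : (Fin i → ι) → M)
    (hc : y • c = 0) : c = 0 := by
  ext j
  exact hy.right_eq_zero_of_smul (congrFun hc j)

/-- Koszul cohomology vanishes in one more degree on `M` than on `M / yM`, for `y` regular. -/
lemma KoszulAcyclicBelow.of_quotient [Fintype ι] (hyx : y ∈ Ideal.span (Set.range x))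
    (hy : IsSMulRegular M y) (hg : Function.Surjective g)
    (hk : ∀ m, g m = 0 ↔ ∃ m', m = y • m') (hN : KoszulAcyclicBelow N x k) :
    KoszulAcyclicBelow M x (k + 1) := by
  obtain ⟨a, rfl⟩ := Ideal.mem_span_range_iff_exists_fun.1 hyx
  intro i hi c hc
  cases i with
  | zero =>
    exact eq_zero_of_smul_cochain_eq_zero hy c (sum_smul_eq_zero_of_koszulDiff_eq_zero x a c hc)
  | succ i =>
    have hw := sum_smul_eq_koszulDiff x a i c hc
    generalize (∑ p, a p • fun l => c (Fin.cons p l)) = w at hw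
    generalize (∑ p, a p * x p) = y at *
    have hgw : koszulDiff x i (g ∘ w) = 0 := by
      rw [koszulDiff_map, ← hw]
      ext j
      simpa using (hk _).2 ⟨c j, rfl⟩
    have hb := hN i (by lia) _ hgw
    obtain ⟨v, hv⟩ : ∃ v, koszulDiff x i w = y • koszulDiff x i v := by
      cases i with
      | zero =>
        obtain ⟨v, rfl⟩ := exists_eq_smul_of_comp_eq_zero (fun m => (hk m).1) w hb
        exact ⟨v, map_smul _ _ _⟩
      | succ i =>
        obtain ⟨u, hu⟩ := hb
        obtain ⟨u, rfl⟩ := hg.comp_left u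
        rw [koszulDiff_map] at hu
        obtain ⟨v, hv⟩ := exists_eq_smul_of_comp_eq_zero (fun m => (hk m).1)
          (w - koszulDiff x i u) (by ext j; simpa [sub_eq_zero] using (congrFun hu j).symm)
        refine ⟨v, ?_⟩
        rw [← map_smul, ← hv, map_sub, koszulDiff_comp_self, sub_zero]
    refine ⟨v, (sub_eq_zero.1 (eq_zero_of_smul_cochain_eq_zero hy _ ?_)).symm⟩
    rw [smul_sub, hw, hv, sub_self]

lemma KoszulAcyclicBelow.quotient (hy : IsSMulRegular M y) (hg : Function.Surjective g)
    (hk : ∀ m, g m = 0 ↔ ∃ m', m = y • m') (hM : KoszulAcyclicBelow M x (k + 1)) :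
    KoszulAcyclicBelow N x k := by
  intro i hi c hc
  obtain ⟨z, rfl⟩ := hg.comp_left c
  rw [koszulDiff_map] at hc
  obtain ⟨w, hw⟩ := exists_eq_smul_of_comp_eq_zero (fun m => (hk m).1) _ hc
  have hdw : koszulDiff x (i + 1) w = 0 := by
    apply eq_zero_of_smul_cochain_eq_zero hy
    rw [← map_smul, ← hw, koszulDiff_comp_self]
  obtain ⟨u, rfl⟩ := hM (i + 1) (by lia) w hdw
  have hgu : g ∘ z = g ∘ (z - y • u) := by
    ext j
    have := (hk _).2 ⟨u j, rfl⟩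
    simp only [Function.comp_apply, Pi.sub_apply, Pi.smul_apply, map_sub, this, sub_zero]
  have hb := hM i (by lia) (z - y • u) (by rw [map_sub, hw, map_smul, sub_self])
  change IsKoszulCoboundary x i (g ∘ z)
  rw [hgu]
  cases i with
  | zero =>
    have hb : z - y • u = 0 := hb
    rw [hb]
    ext; simp
  | succ i =>
    obtain ⟨v, hv⟩ := hb
    exact ⟨g ∘ v, by rw [koszulDiff_map, hv]⟩

open scoped Pointwise in
lemma quotSMulTop_mkQ_eq_zero_iff (y : R) (m : M) :
    (y • (⊤ : Submodule R M)).mkQ m = 0 ↔ ∃ m', m = y • m' := by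
  rw [Submodule.mkQ_apply, Submodule.Quotient.mk_eq_zero, Submodule.mem_smul_pointwise_iff_exists]
  simp [eq_comm]

end Quotient

open RingTheory.Sequence in
lemma KoszulAcyclicBelow.of_isWeaklyRegular [Fintype ι] {x : ι → R} {rs : List R}
    (hrs : ∀ r ∈ rs, r ∈ Ideal.span (Set.range x)) (h : IsWeaklyRegular M rs) :
    KoszulAcyclicBelow M x rs.length := by
  induction rs generalizing M with
  | nil => intro i hi; simp at hi
  | cons r rs ih =>
    rw [isWeaklyRegular_cons_iff] at h
    exact .of_quotient (hrs r (by simp)) h.1 (Submodule.mkQ_surjective _)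
      (quotSMulTop_mkQ_eq_zero_iff r) (ih (fun r' hr' => hrs r' (by simp [hr'])) h.2)

lemma KoszulAcyclicBelow.exists_isSMulRegular [IsNoetherianRing R] [Module.Finite R M]
    {x : ι → R} {k : ℕ} (h : KoszulAcyclicBelow M x (k + 1)) :
    ∃ y ∈ Ideal.span (Set.range x), IsSMulRegular M y := by
  have : Subsingleton ((R ⧸ Ideal.span (Set.range x)) →ₗ[R] M) := by
    refine subsingleton_of_forall_eq 0 fun f => ?_
    have hf : (fun _ : Fin 0 → ι => f 1) = 0 := by
      refine h 0 (by lia) _ ?_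
      ext j
      rw [koszulDiff_zero_apply, ← map_smul, Pi.zero_apply]
      convert map_zero f
      rw [Algebra.smul_def, mul_one, Ideal.Quotient.algebraMap_eq, Ideal.Quotient.eq_zero_iff_mem]
      exact Ideal.subset_span ⟨_, rfl⟩
    ext
    simpa using congrFun hf Fin.elim0
  obtain ⟨y, hy, hreg⟩ := IsSMulRegular.subsingleton_linearMap_iff.1 this
  rw [Ideal.annihilator_quotient] at hy
  exact ⟨y, hy, hreg⟩

open RingTheory.Sequence in
lemma KoszulAcyclicBelow.exists_isWeaklyRegular [IsNoetherianRing R] [Module.Finite R M]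
    {x : ι → R} {k : ℕ} (h : KoszulAcyclicBelow M x k) :
    ∃ rs : List R, rs.length = k ∧ (∀ r ∈ rs, r ∈ Ideal.span (Set.range x)) ∧
      IsWeaklyRegular M rs := by
  induction k generalizing M with
  | zero => exact ⟨[], rfl, by simp, .nil R M⟩
  | succ k ih =>
    obtain ⟨y, hy, hreg⟩ := h.exists_isSMulRegular
    obtain ⟨rs, hl, hrs, hw⟩ := ih (M := QuotSMulTop y M)
      (h.quotient hreg (Submodule.mkQ_surjective _) (quotSMulTop_mkQ_eq_zero_iff y))
    exact ⟨y :: rs, by simp [hl], by simpa [hy] using hrs, .cons hreg hw⟩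

end Koszul

lemma KoszulAcyclicBelow.mono {R ι M : Type*} [CommRing R] [AddCommGroup M] [Module R M]
    {x : ι → R} {k l : ℕ} (h : KoszulAcyclicBelow M x k) (hl : l ≤ k) :
    KoszulAcyclicBelow M x l :=
  fun i hi => h i (hi.trans_le hl)

lemma Submodule.factor_quotientMk {R M : Type*} [Ring R] [AddCommGroup M] [Module R M]
    {p p' : Submodule R M} (h : p ≤ p') (a : M) :
    Submodule.factor h (Submodule.Quotient.mk a) = Submodule.Quotient.mk a := rfl

section Monomial

variable {K : Type*} [Field K] {n : ℕ}

lemma sqm_eq_monomial (T : Finset (Fin n)) :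
    sqm K T = monomial (∑ i ∈ T, Finsupp.single i 1) 1 := by
  rw [monomial_sum_one]
  rfl

lemma sum_single_one_apply (T : Finset (Fin n)) (i : Fin n) :
    (∑ j ∈ T, Finsupp.single j 1 : Fin n →₀ ℕ) i = if i ∈ T then 1 else 0 := by
  simp [Finsupp.finsetSum_apply, Finsupp.single_apply]

lemma sum_single_one_le_iff (T : Finset (Fin n)) (m : Fin n →₀ ℕ) :
    (∑ j ∈ T, Finsupp.single j 1 : Fin n →₀ ℕ) ≤ m ↔ T ⊆ m.support := by
  simp only [Finsupp.le_def, sum_single_one_apply, Finset.subset_iff, Finsupp.mem_support_iff]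
  refine forall_congr' fun i => ?_
  split_ifs with h <;> simp [h, Nat.one_le_iff_ne_zero]

lemma mem_span_sqm_image_iff {G : Set (Finset (Fin n))} {p : MvPolynomial (Fin n) K} :
    p ∈ Ideal.span (sqm K '' G) ↔ ∀ m ∈ p.support, ∃ U ∈ G, U ⊆ m.support := by
  have : sqm K '' G = (fun s => monomial s (1 : K)) ''
      ((fun T : Finset (Fin n) => ∑ i ∈ T, Finsupp.single i 1) '' G) := by
    rw [Set.image_image]
    simp only [sqm_eq_monomial]
  rw [this, mem_ideal_span_monomial_image]
  simp [sum_single_one_le_iff]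

lemma sqm_mem_span_sqm_image_iff {G : Set (Finset (Fin n))} {T : Finset (Fin n)} :
    sqm K T ∈ Ideal.span (sqm K '' G) ↔ ∃ U ∈ G, U ⊆ T := by
  have : (∑ j ∈ T, Finsupp.single j 1 : Fin n →₀ ℕ).support = T := by
    ext i
    simp [sum_single_one_apply]
  classical
  rw [mem_span_sqm_image_iff, sqm_eq_monomial, support_monomial]
  simp [this]

lemma X_mul_sqm_erase {T : Finset (Fin n)} {i : Fin n} (hi : i ∈ T) :
    X i * sqm K (T.erase i) = sqm K T :=
  Finset.mul_prod_erase T _ hi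

lemma sqm_mem_pow_idealOfVars {T : Finset (Fin n)} {k : ℕ} :
    sqm K T ∈ idealOfVars (Fin n) K ^ k ↔ k ≤ T.card := by
  classical
  rw [mem_pow_idealOfVars_iff, sqm_eq_monomial, support_monomial]
  simp

lemma sqfreeGenFrom_le_pow_idealOfVars {L : Ideal (MvPolynomial (Fin n) K)} {k : ℕ}
    (h : SqfreeGenFrom L k) : L ≤ idealOfVars (Fin n) K ^ k := by
  obtain ⟨G, hG, rfl⟩ := h
  rw [Ideal.span_le]
  rintro _ ⟨T, hT, rfl⟩
  exact sqm_mem_pow_idealOfVars.2 (hG T hT)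

lemma X_mul_mem_span_X_image {s : Set (Fin n)} {i : Fin n} (hi : i ∉ s)
    {p : MvPolynomial (Fin n) K} (h : X i * p ∈ Ideal.span (X '' s)) :
    p ∈ Ideal.span (X '' s) := by
  rw [mem_ideal_span_X_image] at h ⊢
  intro m hm
  obtain ⟨j, hj, hmj⟩ := h (Finsupp.single i 1 + m) (by
    rw [mem_support_iff, coeff_X_mul]
    exact mem_support_iff.1 hm)
  have : i ≠ j := fun h => hi (h ▸ hj)
  exact ⟨j, hj, by simpa [Finsupp.single_apply, this] using hmj⟩

/-- The polynomial ring in the variables indexed by `T` has Koszul depth at least `|T|`. -/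
lemma koszulAcyclicBelow_quotient_span_X (T : Finset (Fin n)) :
    KoszulAcyclicBelow (MvPolynomial (Fin n) K ⧸
      (Ideal.span (X '' (T : Set (Fin n))ᶜ) : Ideal (MvPolynomial (Fin n) K)))
      (X : Fin n → MvPolynomial (Fin n) K) T.card := by
  induction T using Finset.induction_on with
  | empty => intro i hi; simp at hi
  | insert a T ha ih =>
    rw [Finset.card_insert_of_notMem ha]
    have hcompl : (T : Set (Fin n))ᶜ = insert a ((insert a T : Finset (Fin n)) : Set (Fin n))ᶜ := by
      ext i
      by_cases h : i = a
      · simp [h, ha]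
      · simp [h]
    have hle : Ideal.span (X '' ((insert a T : Finset (Fin n)) : Set (Fin n))ᶜ) ≤
        Ideal.span (X '' (T : Set (Fin n))ᶜ : Set (MvPolynomial (Fin n) K)) :=
      Ideal.span_mono (Set.image_mono (by simp))
    refine ih.of_quotient (y := X a) (g := Submodule.factor hle) (Ideal.subset_span ⟨a, rfl⟩)
      ?_ (Submodule.factor_surjective hle) ?_
    · rw [isSMulRegular_iff_right_eq_zero_of_smul]
      intro m hm
      obtain ⟨p, rfl⟩ := Submodule.Quotient.mk_surjective _ m
      rw [← Submodule.Quotient.mk_smul, Submodule.Quotient.mk_eq_zero] at hm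
      rw [Submodule.Quotient.mk_eq_zero]
      exact X_mul_mem_span_X_image (by simp) hm
    · intro m
      obtain ⟨p, rfl⟩ := Submodule.Quotient.mk_surjective _ m
      rw [Submodule.factor_quotientMk, Submodule.Quotient.mk_eq_zero, hcompl,
        Set.image_insert_eq, Ideal.mem_span_insert]
      constructor
      · rintro ⟨q, z, hz, rfl⟩
        refine ⟨Submodule.Quotient.mk q, ?_⟩
        rw [← Submodule.Quotient.mk_smul, Submodule.Quotient.eq]
        simpa [mul_comm] using hz
      · rintro ⟨m', hm'⟩
        obtain ⟨q, rfl⟩ := Submodule.Quotient.mk_surjective _ m'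
        rw [← Submodule.Quotient.mk_smul, Submodule.Quotient.eq] at hm'
        exact ⟨q, _, hm', by simp [mul_comm]⟩

lemma mul_sqm_mem_iff_of_maximal {I J : Ideal (MvPolynomial (Fin n) K)}
    (hJ : IsSqfreeMonomialIdeal J) {T : Finset (Fin n)} (hT : Maximal (· ∈ sqPoset I J) T)
    (p : MvPolynomial (Fin n) K) :
    p * sqm K T ∈ J ↔ p ∈ Ideal.span (X '' (T : Set (Fin n))ᶜ) := by
  constructor
  · obtain ⟨G, rfl⟩ := hJ
    intro hp
    rw [mem_ideal_span_X_image]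
    intro m hm
    by_contra! hmT
    rw [mem_span_sqm_image_iff] at hp
    obtain ⟨U, hU, hUm⟩ := hp (m + ∑ i ∈ T, Finsupp.single i 1) (by
      rw [mem_support_iff, sqm_eq_monomial, coeff_mul_monomial, mul_one]
      exact mem_support_iff.1 hm)
    refine hT.prop.2 (sqm_mem_span_sqm_image_iff.2 ⟨U, hU, fun i hi => ?_⟩)
    by_contra hiT
    have := hUm hi
    rw [Finsupp.mem_support_iff, Finsupp.add_apply, sum_single_one_apply, if_neg hiT,
      hmT i (by simpa using hiT)] at this
    exact this rfl
  · intro hp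
    suffices Ideal.span (X '' (T : Set (Fin n))ᶜ) ≤ J.colon {sqm K T} by
      simpa [Submodule.mem_colon_singleton] using this hp
    rw [Ideal.span_le]
    rintro _ ⟨i, hi, rfl⟩
    rw [SetLike.mem_coe, Submodule.mem_colon_singleton, smul_eq_mul]
    have hiT : i ∉ T := by simpa using hi
    have h : X i * sqm K T = sqm K (insert i T) := by
      rw [← X_mul_sqm_erase (Finset.mem_insert_self i T), Finset.erase_insert hiT]
    rw [h]
    by_contra hJ'
    refine hiT (hT.le_of_ge ⟨?_, hJ'⟩ (Finset.subset_insert i T) (Finset.mem_insert_self i T))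
    rw [← h]
    exact I.mul_mem_left _ hT.prop.1

/-- If all squarefree monomials of `I \ J` have degree at least `d`, then `I/J` has Koszul depth
at least `d`. -/
lemma koszulAcyclicBelow_quotMod {I : Ideal (MvPolynomial (Fin n) K)}
    (hI : IsSqfreeMonomialIdeal I) (d : ℕ) (J : Ideal (MvPolynomial (Fin n) K))
    (hJ : IsSqfreeMonomialIdeal J) (hd : ∀ T ∈ sqPoset I J, d ≤ T.card) :
    KoszulAcyclicBelow (quotMod I J) (X : Fin n → MvPolynomial (Fin n) K) d := by
  induction hN : (sqPoset I J).ncard using Nat.strong_induction_on generalizing J with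
  | _ N ih =>
    subst hN
    rcases (sqPoset I J).eq_empty_or_nonempty with hemp | hne
    · have hIJ : I ≤ J := by
        obtain ⟨G, rfl⟩ := hI
        rw [Ideal.span_le]
        rintro _ ⟨T, hT, rfl⟩
        by_contra h
        exact Set.eq_empty_iff_forall_notMem.1 hemp T ⟨Ideal.subset_span ⟨T, hT, rfl⟩, h⟩
      have : Subsingleton (quotMod I J) := by
        rw [Submodule.Quotient.subsingleton_iff, eq_top_iff]
        exact fun a _ => hIJ a.2
      intro i _ c _
      cases i with
      | zero => exact Subsingleton.elim _ _
      | succ i => exact ⟨0, Subsingleton.elim _ _⟩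
    · obtain ⟨T, hT⟩ := (Set.toFinite (sqPoset I J)).exists_maximal hne
      have hTI : sqm K T ∈ I := hT.prop.1
      have hle : J ≤ J ⊔ Ideal.span {sqm K T} := le_sup_left
      have hJ' : IsSqfreeMonomialIdeal (J ⊔ Ideal.span {sqm K T}) := by
        obtain ⟨G, rfl⟩ := hJ
        exact ⟨G ∪ {T}, by rw [Set.image_union, Ideal.span_union, Set.image_singleton]⟩
      have hTJ : sqm K T ∈ J ⊔ Ideal.span {sqm K T} :=
        Ideal.mem_sup_right (Ideal.mem_span_singleton_self _)
      have hss : sqPoset I (J ⊔ Ideal.span {sqm K T}) ⊆ sqPoset I J :=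
        fun U hU => ⟨hU.1, fun h => hU.2 (hle h)⟩
      have hP := ih _ (Set.ncard_lt_ncard ((Set.ssubset_iff_of_subset hss).2
        ⟨T, hT.prop, fun h => h.2 hTJ⟩)) _ hJ' (fun U hU => hd U (hss hU)) rfl
      have hker : LinearMap.ker (LinearMap.toSpanSingleton (MvPolynomial (Fin n) K) (quotMod I J)
          (Submodule.Quotient.mk ⟨sqm K T, hTI⟩)) =
          Ideal.span (X '' (T : Set (Fin n))ᶜ) := by
        ext p
        rw [LinearMap.mem_ker, LinearMap.toSpanSingleton_apply, ← Submodule.Quotient.mk_smul,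
          Submodule.Quotient.mk_eq_zero, ← mul_sqm_mem_iff_of_maximal hJ hT]
        rfl
      refine .of_exact (f := Submodule.liftQ _ _ hker.ge)
        (g := Submodule.factor (Submodule.comap_mono hle)) ?_ ?_
        (Submodule.factor_surjective _)
        ((koszulAcyclicBelow_quotient_span_X T).mono (hd T hT.prop)) hP
      · rw [← LinearMap.ker_eq_bot]
        exact Submodule.ker_liftQ_eq_bot _ _ _ hker.le
      · intro a
        obtain ⟨a, rfl⟩ := Submodule.Quotient.mk_surjective _ a
        rw [Submodule.factor_quotientMk, Submodule.Quotient.mk_eq_zero,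
          Submodule.mem_comap, Submodule.subtype_apply, sup_comm, Ideal.mem_span_singleton_sup]
        constructor
        · rintro ⟨p, b, hb, hab⟩
          refine ⟨Submodule.Quotient.mk p, ?_⟩
          rw [Submodule.liftQ_apply, LinearMap.toSpanSingleton_apply, ← Submodule.Quotient.mk_smul,
            eq_comm, Submodule.Quotient.eq, Submodule.mem_comap]
          simpa [← hab] using hb
        · rintro ⟨p, hp⟩
          obtain ⟨p, rfl⟩ := Submodule.Quotient.mk_surjective _ p
          rw [Submodule.liftQ_apply, LinearMap.toSpanSingleton_apply,
            ← Submodule.Quotient.mk_smul, eq_comm, Submodule.Quotient.eq,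
            Submodule.mem_comap] at hp
          exact ⟨p, _, hp, by simp⟩

lemma quotMod_mk_notMem_smul_top {I J : Ideal (MvPolynomial (Fin n) K)} {d : ℕ}
    (hI : SqfreeGenFrom I d) (hJ : SqfreeGenFrom J (d + 1)) {U : Finset (Fin n)}
    (hU : U.card = d) (hUI : sqm K U ∈ I) :
    (Submodule.Quotient.mk ⟨sqm K U, hUI⟩ : quotMod I J) ∉
      idealOfVars (Fin n) K • (⊤ : Submodule (MvPolynomial (Fin n) K) (quotMod I J)) := by
  intro hmem
  let Φ : quotMod I J →ₗ[MvPolynomial (Fin n) K]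
      MvPolynomial (Fin n) K ⧸ idealOfVars (Fin n) K ^ (d + 1) :=
    Submodule.mapQ _ _ I.subtype
      (Submodule.comap_mono (sqfreeGenFrom_le_pow_idealOfVars hJ))
  have hΦ : ∀ a ∈ idealOfVars (Fin n) K •
      (⊤ : Submodule (MvPolynomial (Fin n) K) (quotMod I J)), Φ a = 0 := by
    intro a ha
    induction ha using Submodule.smul_induction_on' with
    | smul r hr a _ =>
      obtain ⟨a, rfl⟩ := Submodule.Quotient.mk_surjective _ a
      rw [← Submodule.Quotient.mk_smul, Submodule.mapQ_apply, Submodule.Quotient.mk_eq_zero,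
        pow_succ']
      exact Ideal.mul_mem_mul hr (sqfreeGenFrom_le_pow_idealOfVars hI a.2)
    | add a _ b _ ha hb => rw [map_add, ha, hb, add_zero]
  have := hΦ _ hmem
  rw [Submodule.mapQ_apply, Submodule.Quotient.mk_eq_zero, Submodule.subtype_apply,
    sqm_mem_pow_idealOfVars] at this
  lia

lemma sum_neg_one_pow_mul_det_eq_zero {R ι : Type*} [CommRing R] {m : ℕ}
    (row : Fin (m + 1) → ι → R) (hrow : row 0 = 1) (j : Fin (m + 2) → ι) :
    ∑ k : Fin (m + 2), (-1) ^ (k : ℕ) *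
      (Matrix.of fun a b => row a (j (k.succAbove b))).det = 0 := by
  let A : Matrix (Fin (m + 2)) (Fin (m + 2)) R :=
    Matrix.of fun a b => (Fin.cons 1 row : Fin (m + 2) → ι → R) a (j b)
  have hA : A.det = 0 := Matrix.det_zero_of_row_eq (i := 0) (j := 1) (by simp) (by
    ext b
    change _ = row 0 (j b)
    rw [hrow]
    rfl)
  rw [Matrix.det_succ_row_zero] at hA
  rw [← hA]
  refine Finset.sum_congr rfl fun k _ => ?_
  have h0 : A 0 k = 1 := rfl
  rw [h0, mul_one]
  rfl

/-- Cochains supported on injective tuples, built from an alternating constant cocycle `c` and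
elements `e U` whose multiples `x_p e_{W \ p}` depend only on `W`, are cocycles. -/
lemma koszulDiff_smul_eq_zero {R ι M : Type*} [CommRing R] [AddCommGroup M] [Module R M]
    [DecidableEq ι] (x : ι → R) {i : ℕ} (c : (Fin i → ι) → R) (e : Finset ι → M)
    (hc : ∀ j : Fin (i + 1) → ι,
      ∑ k : Fin (i + 1), (-1) ^ (k : ℕ) * c (fun l => j (k.succAbove l)) = 0)
    (hinj : ∀ j, ¬ Function.Injective j → c j = 0)
    (he : ∀ W : Finset ι, W.card = i + 1 → ∃ m, ∀ p ∈ W, x p • e (W.erase p) = m) :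
    koszulDiff x i (fun j => c j • e (Finset.univ.image j)) = 0 := by
  ext j
  obtain ⟨m, hm⟩ : ∃ m, ∀ k : Fin (i + 1), c (fun l => j (k.succAbove l)) ≠ 0 →
      x (j k) • e (Finset.univ.image fun l => j (k.succAbove l)) = m := by
    by_cases hj : Function.Injective j
    · obtain ⟨m, hm⟩ := he (Finset.univ.image j) (by simp [Finset.card_image_of_injective _ hj])
      refine ⟨m, fun k _ => ?_⟩
      rw [← hm (j k) (by simp), ← Finset.image_erase hj]
      congr 2
      ext q
      simp only [Finset.mem_image, Finset.mem_univ, true_and, Finset.mem_erase, and_true]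
      constructor
      · rintro ⟨l, rfl⟩
        exact ⟨_, Fin.succAbove_ne k l, rfl⟩
      · rintro ⟨l, hl, rfl⟩
        obtain ⟨l, rfl⟩ := Fin.exists_succAbove_eq hl
        exact ⟨l, rfl⟩
    · obtain ⟨a, b, hab, hne⟩ : ∃ a b, j a = j b ∧ a ≠ b := by
        simpa [Function.Injective] using hj
      refine ⟨x (j a) • e (Finset.univ.image j), fun k hk => ?_⟩
      have hkinj : Function.Injective fun l => j (k.succAbove l) := by
        by_contra h
        exact hk (hinj _ h)
      obtain ⟨k', hk', hjk⟩ : ∃ k', k' ≠ k ∧ j k' = j k ∧ j k = j a := by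
        by_cases hka : k = a
        · exact ⟨b, hka ▸ hne.symm, hka ▸ hab.symm, hka ▸ rfl⟩
        · by_cases hkb : k = b
          · exact ⟨a, hkb ▸ hne, hkb ▸ hab, hkb ▸ hab.symm⟩
          · obtain ⟨a', rfl⟩ := Fin.exists_succAbove_eq (Ne.symm hka)
            obtain ⟨b', rfl⟩ := Fin.exists_succAbove_eq (Ne.symm hkb)
            exact absurd (congrArg k.succAbove (hkinj hab)) hne
      rw [hjk.2]
      congr 2
      ext q
      simp only [Finset.mem_image, Finset.mem_univ, true_and]
      constructor
      · rintro ⟨l, rfl⟩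
        exact ⟨_, rfl⟩
      · rintro ⟨l, rfl⟩
        by_cases hl : l = k
        · obtain ⟨l', rfl⟩ := Fin.exists_succAbove_eq hk'
          exact ⟨l', by rw [hl, hjk.1]⟩
        · obtain ⟨l', rfl⟩ := Fin.exists_succAbove_eq hl
          exact ⟨l', rfl⟩
  calc koszulDiff x i (fun j => c j • e (Finset.univ.image j)) j
      = ∑ k : Fin (i + 1), ((-1) ^ (k : ℕ) * c (fun l => j (k.succAbove l))) • m := by
        rw [koszulDiff_apply]
        refine Finset.sum_congr rfl fun k _ => ?_
        by_cases hk : c (fun l => j (k.succAbove l)) = 0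
        · simp [hk]
        · rw [← hm k hk, smul_smul, smul_smul]
          congr 1
          ring
    _ = 0 := by rw [← Finset.sum_smul, hc, zero_smul]

lemma exists_smul_eq_of_degSet {I J : Ideal (MvPolynomial (Fin n) K)} {d : ℕ}
    {F : Set (Finset (Fin n))} [DecidablePred (· ∈ F)] (hF : ∀ U ∈ F, sqm K U ∈ I)
    (hdiv : ∀ b ∈ degSet I J (d + 1), ∀ T ⊆ b, T.card = d → T ∈ F)
    {W : Finset (Fin n)} (hW : W.card = d + 1) :
    ∃ m : quotMod I J, ∀ p ∈ W, (X p : MvPolynomial (Fin n) K) •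
      (if h : W.erase p ∈ F then Submodule.Quotient.mk ⟨sqm K (W.erase p), hF _ h⟩
        else (0 : quotMod I J)) = m := by
  by_cases hWB : W ∈ degSet I J (d + 1)
  · have hWI : sqm K W ∈ I := hWB.1.1
    refine ⟨Submodule.Quotient.mk ⟨sqm K W, hWI⟩, fun p hp => ?_⟩
    have hpF := hdiv W hWB _ (Finset.erase_subset p W) (by simp [Finset.card_erase_of_mem hp, hW])
    rw [dif_pos hpF, ← Submodule.Quotient.mk_smul]
    congr 1
    exact Subtype.ext (X_mul_sqm_erase hp)
  · refine ⟨0, fun p hp => ?_⟩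
    split_ifs with h
    · rw [← Submodule.Quotient.mk_smul, Submodule.Quotient.mk_eq_zero, Submodule.mem_comap]
      change X p * sqm K (W.erase p) ∈ J
      rw [X_mul_sqm_erase hp]
      by_contra hJ
      refine hWB ⟨⟨?_, hJ⟩, hW⟩
      rw [← X_mul_sqm_erase hp]
      exact I.mul_mem_left _ (hF _ h)
    · exact smul_zero _

/-- If all degree `d` divisors of the squarefree monomials of degree `d + 1` in `I \ J` are
generators of `I`, then the Koszul cohomology of `I/J` in degree `d` does not vanish. -/
lemma not_koszulAcyclicBelow_quotMod {I J : Ideal (MvPolynomial (Fin n) K)} {d : ℕ} (hd : 0 < d)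
    {F : Set (Finset (Fin n))} (hne : F.Nonempty) (hFd : ∀ U ∈ F, U.card = d)
    (hI : I = Ideal.span (sqm K '' F)) (hJ : SqfreeGenFrom J (d + 1))
    (hdiv : ∀ b ∈ degSet I J (d + 1), ∀ T ⊆ b, T.card = d → T ∈ F) :
    ¬ KoszulAcyclicBelow (quotMod I J) (X : Fin n → MvPolynomial (Fin n) K) (d + 1) := by
  classical
  intro hac
  obtain ⟨m, rfl⟩ : ∃ m, d = m + 1 := ⟨d - 1, by lia⟩
  obtain ⟨U, hU⟩ := hne
  have hF : ∀ U ∈ F, sqm K U ∈ I := fun U hU => hI ▸ Ideal.subset_span ⟨U, hU, rfl⟩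
  let t : Fin (m + 1) → Fin n := U.orderEmbOfFin (hFd U hU)
  have ht : Function.Injective t := (U.orderEmbOfFin (hFd U hU)).injective
  have htU : Finset.univ.image t = U := Finset.image_orderEmbOfFin_univ U (hFd U hU)
  let row : Fin (m + 1) → Fin n → MvPolynomial (Fin n) K :=
    fun a q => if a = 0 then 1 else if q = t a then 1 else 0
  let c : (Fin (m + 1) → Fin n) → MvPolynomial (Fin n) K :=
    fun j => (Matrix.of fun a b => row a (j b)).det
  let e : Finset (Fin n) → quotMod I J :=
    fun V => if h : V ∈ F then Submodule.Quotient.mk ⟨sqm K V, hF V h⟩ else 0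
  have hct : c t = 1 := by
    have htri : (Matrix.of fun a b => row a (t b)).IsUpperTriangular := by
      intro a b hba
      have ha : a ≠ 0 := (lt_of_le_of_lt (Fin.zero_le _) hba).ne'
      have hba' : b < a := hba
      simp [row, ha, ht.eq_iff, hba'.ne]
    change Matrix.det _ = 1
    rw [Matrix.det_of_isUpperTriangular htri]
    simp [row]
  have hz := koszulDiff_smul_eq_zero (X : Fin n → MvPolynomial (Fin n) K) c e
    (sum_neg_one_pow_mul_det_eq_zero row (by ext; simp [row]))
    (fun j hj => by
      obtain ⟨a, b, hab, hne⟩ : ∃ a b, j a = j b ∧ a ≠ b := by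
        simpa [Function.Injective] using hj
      exact Matrix.det_zero_of_column_eq hne (by simp [hab]))
    (fun W hW => exists_smul_eq_of_degSet hF hdiv hW)
  obtain ⟨b, hb⟩ := hac (m + 1) (by lia) _ hz
  refine quotMod_mk_notMem_smul_top ⟨F, fun V hV => (hFd V hV).ge, hI⟩ hJ (hFd U hU) (hF U hU) ?_
  have hbt := congrFun hb t
  simp only [hct, htU, one_smul, e, dif_pos hU] at hbt
  rw [← hbt, koszulDiff_apply]
  refine Submodule.sum_mem _ fun k _ => Submodule.smul_mem_smul ?_ Submodule.mem_top
  exact Ideal.mul_mem_left _ _ (Ideal.subset_span ⟨_, rfl⟩)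

end Monomial

/-- if every degree-`d` divisor of every `b ∈ B` is one of the
generators `f_1, …, f_r`, then `depth I/J = d`. -/
theorem statement6 {K : Type*} [Field K] {n : ℕ} (d : ℕ) (hd : 0 < d) (r : ℕ)
    (I J : Ideal (MvPolynomial (Fin n) K)) (hJI : J < I)
    (f : Fin r → Finset (Fin n)) (hfd : ∀ i, (f i).card = d)
    (hI : I = Ideal.span (sqm K '' Set.range f))
    (hJ : SqfreeGenFrom J (d + 1))
    (hdiv : ∀ b ∈ degSet I J (d + 1), ∀ T ⊆ b, T.card = d → T ∈ Set.range f) :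
    depthIJ I J = d := by
  have hIgen : SqfreeGenFrom I d := by
    refine ⟨Set.range f, ?_, hI⟩
    rintro _ ⟨i, rfl⟩
    exact (hfd i).ge
  have hne : (Set.range f).Nonempty := by
    rw [Set.nonempty_iff_ne_empty]
    intro h
    rw [h, Set.image_empty, Ideal.span_empty] at hI
    exact not_lt_bot (hI ▸ hJI)
  have hfd' : ∀ U ∈ Set.range f, U.card = d := by
    rintro _ ⟨i, rfl⟩
    exact hfd i
  have hlower : KoszulAcyclicBelow (quotMod I J) (X : Fin n → MvPolynomial (Fin n) K) d := by
    obtain ⟨GJ, -, hGJ⟩ := hJ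
    refine koszulAcyclicBelow_quotMod ⟨_, hI⟩ d J ⟨GJ, hGJ⟩ fun T hT => ?_
    have hTI : sqm K T ∈ I := hT.1
    rw [hI, sqm_mem_span_sqm_image_iff] at hTI
    obtain ⟨U, hU, hUT⟩ := hTI
    exact (hfd' U hU).ge.trans (Finset.card_le_card hUT)
  refine IsGreatest.csSup_eq ⟨?_, ?_⟩
  · obtain ⟨rs, hl, hrs, hw⟩ := hlower.exists_isWeaklyRegular
    refine ⟨rs, hl, hrs, hw, fun htop => ?_⟩
    obtain ⟨U, hU⟩ := hne
    have hUI : sqm K U ∈ I := hI ▸ Ideal.subset_span ⟨U, hU, rfl⟩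
    refine quotMod_mk_notMem_smul_top hIgen hJ (hfd' U hU) hUI ?_
    refine Submodule.smul_mono_left ?_ (htop ▸ Submodule.mem_top)
    exact Ideal.span_le.2 hrs
  · rintro k ⟨rs, rfl, hrs, hreg⟩
    by_contra! hlt
    exact not_koszulAcyclicBelow_quotMod hd hne hfd' hI hJ hdiv
      ((KoszulAcyclicBelow.of_isWeaklyRegular hrs hreg.toIsWeaklyRegular).mono hlt)
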